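/- Every constituent graph of an association scheme is 1/2-regular: if α : V → V → C defines an association scheme and G is a constituent graph of this scheme, then for all vertices x, x' and all i ∈ ℕ, R_i (x, x) (x', x') holds. -/

import Mathlib

/-- The iterated 2-dimensional Weisfeiler-Leman equivalence relations `R_i` on
pairs of vertices of a simple graph `G`. -/
def wlRel {V : Type*} (G : SimpleGraph V) : ℕ → V × V → V × V → Prop
  | 0, p, q => ((p.1 = p.2) ↔ (q.1 = q.2)) ∧ (G.Adj p.1 p.2 ↔ G.Adj q.1 q.2)
  | i + 1, p, q => wlRel G i p q ∧ ∀ uv u'v' : V × V,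
      Nat.card {z : V // wlRel G i (p.1, z) uv ∧ wlRel G i (z, p.2) u'v'} =
      Nat.card {z : V // wlRel G i (q.1, z) uv ∧ wlRel G i (z, q.2) u'v'}

theorem wlRel_symm' {V : Type*} (G : SimpleGraph V) (i : ℕ) :
    ∀ p q : V × V, wlRel G i p q → wlRel G i q p := by
  induction i with
  | zero => exact fun p q h => ⟨h.1.symm, h.2.symm⟩
  | succ i ih => exact fun p q h => ⟨ih _ _ h.1, fun u v => (h.2 u v).symm⟩

theorem wlRel_trans' {V : Type*} (G : SimpleGraph V) (i : ℕ) :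
    ∀ p q r : V × V, wlRel G i p q → wlRel G i q r → wlRel G i p r := by
  induction i with
  | zero => exact fun p q r h k => ⟨h.1.trans k.1, h.2.trans k.2⟩
  | succ i ih =>
    exact fun p q r h k => ⟨ih _ _ _ h.1 k.1, fun u v => (h.2 u v).trans (k.2 u v)⟩

theorem exists_fiber_equiv {V D : Type*} [Finite V] (f g : V → D)
    (h : ∀ d, Nat.card {z // f z = d} = Nat.card {z // g z = d}) :
    ∃ e : V ≃ V, ∀ z, g (e z) = f z :=
  ⟨Equiv.ofFiberEquiv (fun d => (Finite.card_eq.mp (h d)).some),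
    fun z => Equiv.ofFiberEquiv_map _ z⟩

/-- Every constituent graph of an association scheme is
`1/2`-regular: all diagonal pairs `(x, x)` get the same stable WL2-color. -/
theorem constituent_is_half_regular
    {V C : Type*} [Fintype V] [Fintype C] (α : V → V → C)
    (hdiag : ∀ x y : V, α x x = α y y)
    (hoffdiag : ∀ x y z : V, x ≠ y → α x y ≠ α z z)
    (htrans : ∀ x y x' y' : V, α x y = α x' y' → α y x = α y' x')
    (hstable : ∀ x y x' y' : V, α x y = α x' y' → ∀ c d : C,
      Nat.card {z : V // α x z = c ∧ α z y = d} =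
      Nat.card {z : V // α x' z = c ∧ α z y' = d})
    (G : SimpleGraph V) (c₀ : C) (hc₀ : ∀ x : V, c₀ ≠ α x x)
    (hG : ∀ x y : V, G.Adj x y ↔ (α x y = c₀ ∨ α y x = c₀)) :
    ∀ x x' : V, ∀ i : ℕ, wlRel G i (x, x) (x', x') := by
  have key : ∀ i : ℕ, ∀ p q : V × V, α p.1 p.2 = α q.1 q.2 → wlRel G i p q := by
    intro i
    induction i with
    | zero =>
      rintro ⟨x, y⟩ ⟨x', y'⟩ h
      have h2 := htrans _ _ _ _ h
      dsimp only at h h2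
      refine ⟨⟨?_, ?_⟩, ?_⟩
      · intro e
        dsimp only at e ⊢
        subst e
        by_contra hne
        exact hoffdiag x' y' x hne h.symm
      · intro e
        dsimp only at e ⊢
        subst e
        by_contra hne
        exact hoffdiag x y x' hne h
      · simp only [hG, h, h2]
    | succ i ih =>
      rintro ⟨x, y⟩ ⟨x', y'⟩ h
      refine ⟨ih _ _ h, fun uv uv' => ?_⟩
      obtain ⟨e, he⟩ := exists_fiber_equiv (fun z => (α x z, α z y))
        (fun z => (α x' z, α z y')) (by
          rintro ⟨c, d⟩
          simpa only [Prod.mk.injEq] using hstable x y x' y' h c d)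
      simp only [Prod.mk.injEq] at he
      have tr : ∀ p q r : V × V, α p.1 p.2 = α q.1 q.2 → (wlRel G i p r ↔ wlRel G i q r) :=
        fun p q r hpq => ⟨wlRel_trans' G i _ _ _ (wlRel_symm' G i _ _ (ih _ _ hpq)),
          wlRel_trans' G i _ _ _ (ih _ _ hpq)⟩
      exact Nat.card_congr (e.subtypeEquiv fun z =>
        and_congr (tr _ _ _ (he z).1.symm) (tr _ _ _ (he z).2.symm))
  exact fun x x' i => key i _ _ (hdiag x x')
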